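/- For all n, m, r ≥ 1, one has 𝔰_{n,r}∘(id_{H^{⊗n}}⊗ρ_{m,r}) = (ρ_{m,r}⊗id_{H^{⊗n}})∘(id_{H^{⊗m}}⊗𝔰_{n,r})∘(𝔠_{n,m}⊗id_{A^{⊗r}}) as maps H^{⊗n}⊗H^{⊗m}⊗A^{⊗r} → A^{⊗r}⊗H^{⊗n}. -/

import Mathlib

/-!
For all `n, m, r ≥ 1`,
`𝔰_{n,r}∘(id_{H^{⊗n}}⊗ρ_{m,r}) = (ρ_{m,r}⊗id_{H^{⊗n}})∘(id_{H^{⊗m}}⊗𝔰_{n,r})∘(𝔠_{n,m}⊗id_{A^{⊗r}})`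
as maps `H^{⊗n}⊗H^{⊗m}⊗A^{⊗r} → A^{⊗r}⊗H^{⊗n}`.  (Here `pw k H n` denotes `H^{⊗(n+1)}`,
so the statement below, quantified over all `n m r : ℕ`, covers exactly all `n, m, r ≥ 1`.)
-/

open scoped TensorProduct

universe u

variable (k : Type u) [Field k]

/-- A bundled `k`-vector space. -/
structure VS (k : Type u) [Field k] : Type (u + 1) where
  /-- underlying type -/
  carrier : Type u
  [acg : AddCommGroup carrier]
  [mod : Module k carrier]

attribute [instance] VS.acg VS.mod

instance : CoeSort (VS k) (Type u) := ⟨VS.carrier⟩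

/-- Iterated tensor powers: `pw k M n` is `M^{⊗(n+1)}`, right-nested. -/
noncomputable def pw (M : Type u) [AddCommGroup M] [Module k M] : ℕ → VS k
  | 0 => ⟨M⟩
  | n + 1 => ⟨M ⊗[k] ↥(pw M n)⟩

variable {M : Type u} [AddCommGroup M] [Module k M]

/-- The canonical identification `M^{⊗(n+1)} ⊗ M ≅ M^{⊗(n+2)}`. -/
noncomputable def snoc : ∀ n : ℕ, (↥(pw k M n) ⊗[k] M) ≃ₗ[k] ↥(pw k M (n + 1))
  | 0 => LinearEquiv.refl k (M ⊗[k] M)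
  | n + 1 =>
      (TensorProduct.assoc k M ↥(pw k M n) M) ≪≫ₗ
        TensorProduct.congr (LinearEquiv.refl k M) (snoc n)

section Twist

variable {Hh Aa : Type u} [AddCommGroup Hh] [Module k Hh] [AddCommGroup Aa] [Module k Aa]
variable {k}

/-- `t_{1,l}` : the extension of a twisting-type map `t : Hh⊗Aa → Aa⊗Hh` to
`Hh ⊗ Aa^{⊗(l+1)} → Aa^{⊗(l+1)} ⊗ Hh`, via `t_{1,l+1} := (id_{Aa^{⊗l}}⊗t)∘(t_{1,l}⊗id_{Aa})`. -/
noncomputable def tw1 (t : Hh ⊗[k] Aa →ₗ[k] Aa ⊗[k] Hh) :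
    ∀ l : ℕ, (Hh ⊗[k] ↥(pw k Aa l)) →ₗ[k] (↥(pw k Aa l) ⊗[k] Hh)
  | 0 => t
  | l + 1 =>
      LinearMap.rTensor Hh (snoc k l).toLinearMap
        ∘ₗ (TensorProduct.assoc k ↥(pw k Aa l) Aa Hh).symm.toLinearMap
        ∘ₗ LinearMap.lTensor ↥(pw k Aa l) t
        ∘ₗ (TensorProduct.assoc k ↥(pw k Aa l) Hh Aa).toLinearMap
        ∘ₗ LinearMap.rTensor Aa (tw1 t l)
        ∘ₗ (TensorProduct.assoc k Hh ↥(pw k Aa l) Aa).symm.toLinearMap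
        ∘ₗ LinearMap.lTensor Hh (snoc k l).symm.toLinearMap

/-- `t_{j,l}` : the extension of `t` to `Hh^{⊗(j+1)} ⊗ Aa^{⊗(l+1)} → Aa^{⊗(l+1)} ⊗ Hh^{⊗(j+1)}`,
via `t_{j+1,l} := (t_{1,l}⊗id_{Hh^{⊗j}})∘(id_{Hh}⊗t_{j,l})`. -/
noncomputable def twFull (t : Hh ⊗[k] Aa →ₗ[k] Aa ⊗[k] Hh) :
    ∀ (j l : ℕ), (↥(pw k Hh j) ⊗[k] ↥(pw k Aa l)) →ₗ[k] (↥(pw k Aa l) ⊗[k] ↥(pw k Hh j))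
  | 0, l => tw1 t l
  | j + 1, l =>
      (TensorProduct.assoc k ↥(pw k Aa l) Hh ↥(pw k Hh j)).toLinearMap
        ∘ₗ LinearMap.rTensor ↥(pw k Hh j) (tw1 t l)
        ∘ₗ (TensorProduct.assoc k Hh ↥(pw k Aa l) ↥(pw k Hh j)).symm.toLinearMap
        ∘ₗ LinearMap.lTensor Hh (twFull t j l)
        ∘ₗ (TensorProduct.assoc k Hh ↥(pw k Hh j) ↥(pw k Aa l)).toLinearMap

/-- The bijective version of `tw1`, for a bijective `t`. -/
noncomputable def twE1 (t : Hh ⊗[k] Aa ≃ₗ[k] Aa ⊗[k] Hh) :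
    ∀ l : ℕ, (Hh ⊗[k] ↥(pw k Aa l)) ≃ₗ[k] (↥(pw k Aa l) ⊗[k] Hh)
  | 0 => t
  | l + 1 =>
      TensorProduct.congr (LinearEquiv.refl k Hh) (snoc k l).symm
        ≪≫ₗ (TensorProduct.assoc k Hh ↥(pw k Aa l) Aa).symm
        ≪≫ₗ TensorProduct.congr (twE1 t l) (LinearEquiv.refl k Aa)
        ≪≫ₗ TensorProduct.assoc k ↥(pw k Aa l) Hh Aa
        ≪≫ₗ TensorProduct.congr (LinearEquiv.refl k ↥(pw k Aa l)) t
        ≪≫ₗ (TensorProduct.assoc k ↥(pw k Aa l) Aa Hh).symm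
        ≪≫ₗ TensorProduct.congr (snoc k l) (LinearEquiv.refl k Hh)

/-- The bijective version of `twFull`, for a bijective `t`. -/
noncomputable def twEFull (t : Hh ⊗[k] Aa ≃ₗ[k] Aa ⊗[k] Hh) :
    ∀ (j l : ℕ), (↥(pw k Hh j) ⊗[k] ↥(pw k Aa l)) ≃ₗ[k] (↥(pw k Aa l) ⊗[k] ↥(pw k Hh j))
  | 0, l => twE1 t l
  | j + 1, l =>
      TensorProduct.assoc k Hh ↥(pw k Hh j) ↥(pw k Aa l)
        ≪≫ₗ TensorProduct.congr (LinearEquiv.refl k Hh) (twEFull t j l)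
        ≪≫ₗ (TensorProduct.assoc k Hh ↥(pw k Aa l) ↥(pw k Hh j)).symm
        ≪≫ₗ TensorProduct.congr (twE1 t l) (LinearEquiv.refl k ↥(pw k Hh j))
        ≪≫ₗ TensorProduct.assoc k ↥(pw k Aa l) Hh ↥(pw k Hh j)

end Twist

section Action

variable {Hh Aa : Type u} [AddCommGroup Hh] [Module k Hh] [AddCommGroup Aa] [Module k Aa]
variable {k}

/-- `ρ_l` : the extension `ρ_{l+1} := (ρ_l⊗ρ)∘(id_{Hh}⊗𝔰_{1,l}⊗id_{Aa})∘(Δ⊗id)` of a weak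
action `ρ` to `Hh ⊗ Aa^{⊗(l+1)} → Aa^{⊗(l+1)}`. -/
noncomputable def rhoPow (Δ : Hh →ₗ[k] Hh ⊗[k] Hh) (s : Hh ⊗[k] Aa ≃ₗ[k] Aa ⊗[k] Hh)
    (ρ : Hh ⊗[k] Aa →ₗ[k] Aa) :
    ∀ l : ℕ, (Hh ⊗[k] ↥(pw k Aa l)) →ₗ[k] ↥(pw k Aa l)
  | 0 => ρ
  | l + 1 =>
      (snoc k l).toLinearMap
        ∘ₗ TensorProduct.map (rhoPow Δ s ρ l) ρ
        ∘ₗ (TensorProduct.assoc k Hh ↥(pw k Aa l) (Hh ⊗[k] Aa)).symm.toLinearMap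
        ∘ₗ LinearMap.lTensor Hh (TensorProduct.assoc k ↥(pw k Aa l) Hh Aa).toLinearMap
        ∘ₗ LinearMap.lTensor Hh (LinearMap.rTensor Aa (twE1 s l).toLinearMap)
        ∘ₗ LinearMap.lTensor Hh (TensorProduct.assoc k Hh ↥(pw k Aa l) Aa).symm.toLinearMap
        ∘ₗ (TensorProduct.assoc k Hh Hh (↥(pw k Aa l) ⊗[k] Aa)).toLinearMap
        ∘ₗ LinearMap.rTensor (↥(pw k Aa l) ⊗[k] Aa) Δ
        ∘ₗ LinearMap.lTensor Hh (snoc k l).symm.toLinearMap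

/-- `ρ_{j,l}` : the extension `ρ_{j+1,l} := ρ_{1,l}∘(id_{Hh}⊗ρ_{j,l})`. -/
noncomputable def rhoFull (Δ : Hh →ₗ[k] Hh ⊗[k] Hh) (s : Hh ⊗[k] Aa ≃ₗ[k] Aa ⊗[k] Hh)
    (ρ : Hh ⊗[k] Aa →ₗ[k] Aa) :
    ∀ (j l : ℕ), (↥(pw k Hh j) ⊗[k] ↥(pw k Aa l)) →ₗ[k] ↥(pw k Aa l)
  | 0, l => rhoPow Δ s ρ l
  | j + 1, l =>
      rhoPow Δ s ρ l
        ∘ₗ LinearMap.lTensor Hh (rhoFull Δ s ρ j l)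
        ∘ₗ (TensorProduct.assoc k Hh ↥(pw k Hh j) ↥(pw k Aa l)).toLinearMap

end Action

section ComulPow

variable {Hh : Type u} [AddCommGroup Hh] [Module k Hh]
variable {k}

/-- `Δ^{⊗(n+1)} : Hh^{⊗(n+1)} → (Hh⊗Hh)^{⊗(n+1)}`. -/
noncomputable def dPow (Δ : Hh →ₗ[k] Hh ⊗[k] Hh) :
    ∀ n : ℕ, ↥(pw k Hh n) →ₗ[k] ↥(pw k (Hh ⊗[k] Hh) n)
  | 0 => Δ
  | n + 1 => TensorProduct.map Δ (dPow Δ n)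

/-- `id_{Hh} ⊗ c^{×(n+1)} ⊗ id_{Hh}` : the simultaneous application of `c` to the `n+1`
consecutive interior pairs of tensor factors of `(Hh⊗Hh)^{⊗(n+2)}`. -/
noncomputable def mids (c : Hh ⊗[k] Hh →ₗ[k] Hh ⊗[k] Hh) :
    ∀ n : ℕ, ↥(pw k (Hh ⊗[k] Hh) (n + 1)) →ₗ[k] (Hh ⊗[k] (↥(pw k (Hh ⊗[k] Hh) n) ⊗[k] Hh))
  | 0 =>
      LinearMap.lTensor Hh (LinearMap.rTensor Hh c)
        ∘ₗ LinearMap.lTensor Hh (TensorProduct.assoc k Hh Hh Hh).symm.toLinearMap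
        ∘ₗ (TensorProduct.assoc k Hh Hh (Hh ⊗[k] Hh)).toLinearMap
  | n + 1 =>
      LinearMap.lTensor Hh
          (TensorProduct.assoc k (Hh ⊗[k] Hh) ↥(pw k (Hh ⊗[k] Hh) n) Hh).symm.toLinearMap
        ∘ₗ LinearMap.lTensor Hh (LinearMap.rTensor (↥(pw k (Hh ⊗[k] Hh) n) ⊗[k] Hh) c)
        ∘ₗ LinearMap.lTensor Hh
            (TensorProduct.assoc k Hh Hh (↥(pw k (Hh ⊗[k] Hh) n) ⊗[k] Hh)).symm.toLinearMap
        ∘ₗ (TensorProduct.assoc k Hh Hh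
            (Hh ⊗[k] (↥(pw k (Hh ⊗[k] Hh) n) ⊗[k] Hh))).toLinearMap
        ∘ₗ LinearMap.lTensor (Hh ⊗[k] Hh) (mids c n)

/-- `𝔠_{n+1}` (composed with the regrouping `Hh^{⊗2(n+1)} ≅ Hh^{⊗(n+1)}⊗Hh^{⊗(n+1)}`) :
defined by `𝔠_1 = id` and `𝔠_{n+1} = (id⊗𝔠_n⊗id)∘(id⊗c^{×n}⊗id)`. -/
noncomputable def cShuffle (c : Hh ⊗[k] Hh →ₗ[k] Hh ⊗[k] Hh) :
    ∀ n : ℕ, ↥(pw k (Hh ⊗[k] Hh) n) →ₗ[k] (↥(pw k Hh n) ⊗[k] ↥(pw k Hh n))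
  | 0 => LinearMap.id
  | n + 1 =>
      (TensorProduct.assoc k Hh ↥(pw k Hh n) ↥(pw k Hh (n + 1))).symm.toLinearMap
        ∘ₗ LinearMap.lTensor Hh (LinearMap.lTensor ↥(pw k Hh n) (snoc k n).toLinearMap)
        ∘ₗ LinearMap.lTensor Hh (TensorProduct.assoc k ↥(pw k Hh n) ↥(pw k Hh n) Hh).toLinearMap
        ∘ₗ LinearMap.lTensor Hh (LinearMap.rTensor Hh (cShuffle c n))
        ∘ₗ mids c n

/-- The comultiplication `Δ_{H^{⊗_c(n+1)}} := 𝔠_{n+1}∘Δ^{⊗(n+1)}` of the braided tensor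
power coalgebra. -/
noncomputable def comulP (c : Hh ⊗[k] Hh →ₗ[k] Hh ⊗[k] Hh) (Δ : Hh →ₗ[k] Hh ⊗[k] Hh)
    (n : ℕ) : ↥(pw k Hh n) →ₗ[k] (↥(pw k Hh n) ⊗[k] ↥(pw k Hh n)) :=
  cShuffle c n ∘ₗ dPow Δ n

/-- The counit `ε^{⊗(n+1)}` of the braided tensor power coalgebra. -/
noncomputable def counitP (ε : Hh →ₗ[k] k) : ∀ n : ℕ, ↥(pw k Hh n) →ₗ[k] k
  | 0 => ε
  | n + 1 => (TensorProduct.lid k k).toLinearMap ∘ₗ TensorProduct.map ε (counitP ε n)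

end ComulPow

/-- A braided bialgebra: an algebra-and-coalgebra `H` together with a bijective braiding
operator `c` compatible with both structures, for which `η` is a coalgebra morphism, `ε` is
an algebra morphism and `Δ∘μ = (μ⊗μ)∘(id⊗c⊗id)∘(Δ⊗Δ)`. -/
structure BraidedBialgebra (H : Type u) [Ring H] [Algebra k H] [Coalgebra k H] where
  /-- the braid -/
  c : H ⊗[k] H ≃ₗ[k] H ⊗[k] H
  /-- `(c⊗id)∘(id⊗c)∘(c⊗id) = (id⊗c)∘(c⊗id)∘(id⊗c)` -/
  yang_baxter :
    LinearMap.rTensor H c.toLinearMap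
        ∘ₗ (TensorProduct.assoc k H H H).symm.toLinearMap
        ∘ₗ LinearMap.lTensor H c.toLinearMap
        ∘ₗ (TensorProduct.assoc k H H H).toLinearMap
        ∘ₗ LinearMap.rTensor H c.toLinearMap
      = (TensorProduct.assoc k H H H).symm.toLinearMap
        ∘ₗ LinearMap.lTensor H c.toLinearMap
        ∘ₗ (TensorProduct.assoc k H H H).toLinearMap
        ∘ₗ LinearMap.rTensor H c.toLinearMap
        ∘ₗ (TensorProduct.assoc k H H H).symm.toLinearMap
        ∘ₗ LinearMap.lTensor H c.toLinearMap
        ∘ₗ (TensorProduct.assoc k H H H).toLinearMap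
  /-- `c(h⊗1) = 1⊗h` -/
  braid_one_right : ∀ h : H, c (h ⊗ₜ[k] (1 : H)) = (1 : H) ⊗ₜ[k] h
  /-- `c(1⊗h) = h⊗1` -/
  braid_one_left : ∀ h : H, c ((1 : H) ⊗ₜ[k] h) = h ⊗ₜ[k] (1 : H)
  /-- `c∘(μ⊗id) = (id⊗μ)∘(c⊗id)∘(id⊗c)` -/
  braid_mul_right :
    c.toLinearMap ∘ₗ LinearMap.rTensor H (LinearMap.mul' k H)
      = LinearMap.lTensor H (LinearMap.mul' k H)
        ∘ₗ (TensorProduct.assoc k H H H).toLinearMap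
        ∘ₗ LinearMap.rTensor H c.toLinearMap
        ∘ₗ (TensorProduct.assoc k H H H).symm.toLinearMap
        ∘ₗ LinearMap.lTensor H c.toLinearMap
        ∘ₗ (TensorProduct.assoc k H H H).toLinearMap
  /-- `c∘(id⊗μ) = (μ⊗id)∘(id⊗c)∘(c⊗id)` -/
  braid_mul_left :
    c.toLinearMap ∘ₗ LinearMap.lTensor H (LinearMap.mul' k H)
      = LinearMap.rTensor H (LinearMap.mul' k H)
        ∘ₗ (TensorProduct.assoc k H H H).symm.toLinearMap
        ∘ₗ LinearMap.lTensor H c.toLinearMap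
        ∘ₗ (TensorProduct.assoc k H H H).toLinearMap
        ∘ₗ LinearMap.rTensor H c.toLinearMap
        ∘ₗ (TensorProduct.assoc k H H H).symm.toLinearMap
  /-- `(id⊗ε)∘c = ε⊗id` -/
  braid_counit_right :
    (TensorProduct.rid k H).toLinearMap
        ∘ₗ LinearMap.lTensor H (Coalgebra.counit (R := k) (A := H))
        ∘ₗ c.toLinearMap
      = (TensorProduct.lid k H).toLinearMap
        ∘ₗ LinearMap.rTensor H (Coalgebra.counit (R := k) (A := H))
  /-- `(ε⊗id)∘c = id⊗ε` -/
  braid_counit_left :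
    (TensorProduct.lid k H).toLinearMap
        ∘ₗ LinearMap.rTensor H (Coalgebra.counit (R := k) (A := H))
        ∘ₗ c.toLinearMap
      = (TensorProduct.rid k H).toLinearMap
        ∘ₗ LinearMap.lTensor H (Coalgebra.counit (R := k) (A := H))
  /-- `(id⊗Δ)∘c = (c⊗id)∘(id⊗c)∘(Δ⊗id)` -/
  braid_comul_right :
    LinearMap.lTensor H (Coalgebra.comul (R := k) (A := H)) ∘ₗ c.toLinearMap
      = (TensorProduct.assoc k H H H).toLinearMap
        ∘ₗ LinearMap.rTensor H c.toLinearMap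
        ∘ₗ (TensorProduct.assoc k H H H).symm.toLinearMap
        ∘ₗ LinearMap.lTensor H c.toLinearMap
        ∘ₗ (TensorProduct.assoc k H H H).toLinearMap
        ∘ₗ LinearMap.rTensor H (Coalgebra.comul (R := k) (A := H))
  /-- `(Δ⊗id)∘c = (id⊗c)∘(c⊗id)∘(id⊗Δ)` -/
  braid_comul_left :
    (TensorProduct.assoc k H H H).toLinearMap
        ∘ₗ LinearMap.rTensor H (Coalgebra.comul (R := k) (A := H))
        ∘ₗ c.toLinearMap
      = LinearMap.lTensor H c.toLinearMap
        ∘ₗ (TensorProduct.assoc k H H H).toLinearMap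
        ∘ₗ LinearMap.rTensor H c.toLinearMap
        ∘ₗ (TensorProduct.assoc k H H H).symm.toLinearMap
        ∘ₗ LinearMap.lTensor H (Coalgebra.comul (R := k) (A := H))
  /-- `Δ(1) = 1⊗1` -/
  comul_one : Coalgebra.comul (R := k) (1 : H) = (1 : H) ⊗ₜ[k] (1 : H)
  /-- `ε(1) = 1` -/
  counit_one : Coalgebra.counit (R := k) (1 : H) = (1 : k)
  /-- `ε(hl) = ε(h)ε(l)` -/
  counit_mul : ∀ h l : H,
    Coalgebra.counit (R := k) (h * l)
      = Coalgebra.counit (R := k) h * Coalgebra.counit (R := k) l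
  /-- `Δ∘μ = (μ⊗μ)∘(id⊗c⊗id)∘(Δ⊗Δ)` -/
  comul_mul :
    (Coalgebra.comul (R := k) (A := H)) ∘ₗ LinearMap.mul' k H
      = TensorProduct.map (LinearMap.mul' k H) (LinearMap.mul' k H)
        ∘ₗ (TensorProduct.assoc k H H (H ⊗[k] H)).symm.toLinearMap
        ∘ₗ LinearMap.lTensor H (TensorProduct.assoc k H H H).toLinearMap
        ∘ₗ LinearMap.lTensor H (LinearMap.rTensor H c.toLinearMap)
        ∘ₗ LinearMap.lTensor H (TensorProduct.assoc k H H H).symm.toLinearMap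
        ∘ₗ (TensorProduct.assoc k H H (H ⊗[k] H)).toLinearMap
        ∘ₗ TensorProduct.map (Coalgebra.comul (R := k) (A := H))
            (Coalgebra.comul (R := k) (A := H))

/-- A transposition of the braided bialgebra `(H, c)` on the algebra `A`: a bijective
twisting map `s : H⊗A → A⊗H` compatible with the bialgebra structure of `H`. -/
structure Transposition {H : Type u} [Ring H] [Algebra k H] [Coalgebra k H]
    (c : H ⊗[k] H ≃ₗ[k] H ⊗[k] H) (A : Type u) [Ring A] [Algebra k A] where
  /-- the underlying bijective linear map -/
  s : H ⊗[k] A ≃ₗ[k] A ⊗[k] H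
  /-- `s(h⊗1_A) = 1_A⊗h` -/
  s_one_right : ∀ h : H, s (h ⊗ₜ[k] (1 : A)) = (1 : A) ⊗ₜ[k] h
  /-- `s(1_H⊗a) = a⊗1_H` -/
  s_one_left : ∀ a : A, s ((1 : H) ⊗ₜ[k] a) = a ⊗ₜ[k] (1 : H)
  /-- `s∘(id_H⊗μ_A) = (μ_A⊗id_H)∘(id_A⊗s)∘(s⊗id_A)` -/
  s_mul_A :
    s.toLinearMap ∘ₗ LinearMap.lTensor H (LinearMap.mul' k A)
      = LinearMap.rTensor H (LinearMap.mul' k A)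
        ∘ₗ (TensorProduct.assoc k A A H).symm.toLinearMap
        ∘ₗ LinearMap.lTensor A s.toLinearMap
        ∘ₗ (TensorProduct.assoc k A H A).toLinearMap
        ∘ₗ LinearMap.rTensor A s.toLinearMap
        ∘ₗ (TensorProduct.assoc k H A A).symm.toLinearMap
  /-- `s∘(μ_H⊗id_A) = (id_A⊗μ_H)∘(s⊗id_H)∘(id_H⊗s)` -/
  s_mul_H :
    s.toLinearMap ∘ₗ LinearMap.rTensor A (LinearMap.mul' k H)
      = LinearMap.lTensor A (LinearMap.mul' k H)
        ∘ₗ (TensorProduct.assoc k A H H).toLinearMap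
        ∘ₗ LinearMap.rTensor H s.toLinearMap
        ∘ₗ (TensorProduct.assoc k H A H).symm.toLinearMap
        ∘ₗ LinearMap.lTensor H s.toLinearMap
        ∘ₗ (TensorProduct.assoc k H H A).toLinearMap
  /-- `(id_A⊗ε_H)∘s = ε_H⊗id_A` -/
  s_counit :
    (TensorProduct.rid k A).toLinearMap
        ∘ₗ LinearMap.lTensor A (Coalgebra.counit (R := k) (A := H))
        ∘ₗ s.toLinearMap
      = (TensorProduct.lid k A).toLinearMap
        ∘ₗ LinearMap.rTensor A (Coalgebra.counit (R := k) (A := H))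
  /-- `(id_A⊗Δ_H)∘s = (s⊗id_H)∘(id_H⊗s)∘(Δ_H⊗id_A)` -/
  s_comul :
    LinearMap.lTensor A (Coalgebra.comul (R := k) (A := H)) ∘ₗ s.toLinearMap
      = (TensorProduct.assoc k A H H).toLinearMap
        ∘ₗ LinearMap.rTensor H s.toLinearMap
        ∘ₗ (TensorProduct.assoc k H A H).symm.toLinearMap
        ∘ₗ LinearMap.lTensor H s.toLinearMap
        ∘ₗ (TensorProduct.assoc k H H A).toLinearMap
        ∘ₗ LinearMap.rTensor A (Coalgebra.comul (R := k) (A := H))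
  /-- `(s⊗id_H)∘(id_H⊗s)∘(c⊗id_A) = (id_A⊗c)∘(s⊗id_H)∘(id_H⊗s)` -/
  s_braid :
    (TensorProduct.assoc k A H H).toLinearMap
        ∘ₗ LinearMap.rTensor H s.toLinearMap
        ∘ₗ (TensorProduct.assoc k H A H).symm.toLinearMap
        ∘ₗ LinearMap.lTensor H s.toLinearMap
        ∘ₗ (TensorProduct.assoc k H H A).toLinearMap
        ∘ₗ LinearMap.rTensor A c.toLinearMap
      = LinearMap.lTensor A c.toLinearMap
        ∘ₗ (TensorProduct.assoc k A H H).toLinearMap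
        ∘ₗ LinearMap.rTensor H s.toLinearMap
        ∘ₗ (TensorProduct.assoc k H A H).symm.toLinearMap
        ∘ₗ LinearMap.lTensor H s.toLinearMap
        ∘ₗ (TensorProduct.assoc k H H A).toLinearMap

/-- A weak `s`-action of the braided bialgebra `(H, c)` on the algebra `A`. -/
structure WeakSAction {H A : Type u} [Ring H] [Algebra k H] [Coalgebra k H]
    [Ring A] [Algebra k A]
    (c : H ⊗[k] H ≃ₗ[k] H ⊗[k] H) (s : H ⊗[k] A ≃ₗ[k] A ⊗[k] H) where
  /-- the action map -/
  ρ : H ⊗[k] A →ₗ[k] A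
  /-- `ρ∘(id_H⊗μ_A) = μ_A∘(ρ⊗ρ)∘(id_H⊗s⊗id_A)∘(Δ_H⊗id_{A⊗A})` -/
  rho_mul :
    ρ ∘ₗ LinearMap.lTensor H (LinearMap.mul' k A)
      = LinearMap.mul' k A
        ∘ₗ TensorProduct.map ρ ρ
        ∘ₗ (TensorProduct.assoc k H A (H ⊗[k] A)).symm.toLinearMap
        ∘ₗ LinearMap.lTensor H (TensorProduct.assoc k A H A).toLinearMap
        ∘ₗ LinearMap.lTensor H (LinearMap.rTensor A s.toLinearMap)
        ∘ₗ LinearMap.lTensor H (TensorProduct.assoc k H A A).symm.toLinearMap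
        ∘ₗ (TensorProduct.assoc k H H (A ⊗[k] A)).toLinearMap
        ∘ₗ LinearMap.rTensor (A ⊗[k] A) (Coalgebra.comul (R := k) (A := H))
  /-- `ρ(h⊗1_A) = ε(h)1_A` -/
  rho_one : ∀ h : H, ρ (h ⊗ₜ[k] (1 : A)) = Coalgebra.counit (R := k) h • (1 : A)
  /-- `ρ(1_H⊗a) = a` -/
  one_rho : ∀ a : A, ρ ((1 : H) ⊗ₜ[k] a) = a
  /-- `s∘(id_H⊗ρ) = (ρ⊗id_H)∘(id_H⊗s)∘(c⊗id_A)` -/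
  rho_s :
    s.toLinearMap ∘ₗ LinearMap.lTensor H ρ
      = LinearMap.rTensor H ρ
        ∘ₗ (TensorProduct.assoc k H A H).symm.toLinearMap
        ∘ₗ LinearMap.lTensor H s.toLinearMap
        ∘ₗ (TensorProduct.assoc k H H A).toLinearMap
        ∘ₗ LinearMap.rTensor A c.toLinearMap
        ∘ₗ (TensorProduct.assoc k H H A).symm.toLinearMap

variable {k}

/-- The twisting map `χ := (ρ⊗id_H)∘(id_H⊗s)∘(Δ_H⊗id_A)` associated with a braided
Hopf crossed product datum. -/
noncomputable def chi {H A : Type u} [Ring H] [Algebra k H] [Coalgebra k H]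
    [Ring A] [Algebra k A]
    (s : H ⊗[k] A →ₗ[k] A ⊗[k] H) (ρ : H ⊗[k] A →ₗ[k] A) :
    H ⊗[k] A →ₗ[k] A ⊗[k] H :=
  LinearMap.rTensor H ρ
    ∘ₗ (TensorProduct.assoc k H A H).symm.toLinearMap
    ∘ₗ LinearMap.lTensor H s
    ∘ₗ (TensorProduct.assoc k H H A).toLinearMap
    ∘ₗ LinearMap.rTensor A (Coalgebra.comul (R := k) (A := H))


section TwistStructure

variable {k : Type u} [Field k] {X Y U V W Z : Type u}
  [AddCommGroup X] [Module k X] [AddCommGroup Y] [Module k Y] [AddCommGroup U] [Module k U]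
  [AddCommGroup V] [Module k V] [AddCommGroup W] [Module k W] [AddCommGroup Z] [Module k Z]

/-- The twist of `X` past `V ⊗ W` obtained from twists past `V` and past `W`. -/
noncomputable def twistTensor (σ : X ⊗[k] V →ₗ[k] V ⊗[k] X) (τ : X ⊗[k] W →ₗ[k] W ⊗[k] X) :
    X ⊗[k] (V ⊗[k] W) →ₗ[k] (V ⊗[k] W) ⊗[k] X :=
  (TensorProduct.assoc k V W X).symm.toLinearMap
    ∘ₗ LinearMap.lTensor V τ
    ∘ₗ (TensorProduct.assoc k V X W).toLinearMap
    ∘ₗ LinearMap.rTensor W σ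
    ∘ₗ (TensorProduct.assoc k X V W).symm.toLinearMap

/-- The twist of `X ⊗ Y` past `V` obtained from twists of `X` and of `Y` past `V`. -/
noncomputable def tensorTwist (σ : X ⊗[k] V →ₗ[k] V ⊗[k] X) (τ : Y ⊗[k] V →ₗ[k] V ⊗[k] Y) :
    (X ⊗[k] Y) ⊗[k] V →ₗ[k] V ⊗[k] (X ⊗[k] Y) :=
  (TensorProduct.assoc k V X Y).toLinearMap
    ∘ₗ LinearMap.rTensor Y σ
    ∘ₗ (TensorProduct.assoc k X V Y).symm.toLinearMap
    ∘ₗ LinearMap.lTensor X τ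
    ∘ₗ (TensorProduct.assoc k X Y V).toLinearMap

/-- `f : V → W` is compatible with the twists `σ`, `τ` of `X` past `V` and `W`. -/
def TwistHom (σ : X ⊗[k] V →ₗ[k] V ⊗[k] X) (τ : X ⊗[k] W →ₗ[k] W ⊗[k] X)
    (f : V →ₗ[k] W) : Prop :=
  τ ∘ₗ LinearMap.lTensor X f = LinearMap.rTensor X f ∘ₗ σ

namespace TwistHom

variable {σ : X ⊗[k] V →ₗ[k] V ⊗[k] X} {τ : X ⊗[k] W →ₗ[k] W ⊗[k] X}
  {υ : X ⊗[k] Z →ₗ[k] Z ⊗[k] X} {ω : X ⊗[k] U →ₗ[k] U ⊗[k] X}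

theorem id : TwistHom σ σ LinearMap.id := by
  simp [TwistHom]

theorem comp {g : W →ₗ[k] Z} {f : V →ₗ[k] W} (hg : TwistHom τ υ g) (hf : TwistHom σ τ f) :
    TwistHom σ υ (g ∘ₗ f) := by
  unfold TwistHom at *
  rw [LinearMap.lTensor_comp, LinearMap.rTensor_comp, ← LinearMap.comp_assoc, hg,
    LinearMap.comp_assoc, hf, LinearMap.comp_assoc]

theorem symm {e : V ≃ₗ[k] W} (he : TwistHom σ τ e.toLinearMap) :
    TwistHom τ σ e.symm.toLinearMap := by
  unfold TwistHom at *
  have h₁ : LinearMap.lTensor X e.toLinearMap ∘ₗ LinearMap.lTensor X e.symm.toLinearMap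
      = LinearMap.id := by
    rw [← LinearMap.lTensor_comp]; simp
  have h₂ : LinearMap.rTensor X e.symm.toLinearMap ∘ₗ LinearMap.rTensor X e.toLinearMap
      = LinearMap.id := by
    rw [← LinearMap.rTensor_comp]; simp
  calc σ ∘ₗ LinearMap.lTensor X e.symm.toLinearMap
      = (LinearMap.rTensor X e.symm.toLinearMap ∘ₗ LinearMap.rTensor X e.toLinearMap) ∘ₗ σ
          ∘ₗ LinearMap.lTensor X e.symm.toLinearMap := by rw [h₂, LinearMap.id_comp]
    _ = LinearMap.rTensor X e.symm.toLinearMap ∘ₗ (LinearMap.rTensor X e.toLinearMap ∘ₗ σ)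
          ∘ₗ LinearMap.lTensor X e.symm.toLinearMap := by simp only [LinearMap.comp_assoc]
    _ = LinearMap.rTensor X e.symm.toLinearMap ∘ₗ τ
          ∘ₗ (LinearMap.lTensor X e.toLinearMap ∘ₗ LinearMap.lTensor X e.symm.toLinearMap) := by
        rw [← he]; simp only [LinearMap.comp_assoc]
    _ = LinearMap.rTensor X e.symm.toLinearMap ∘ₗ τ := by rw [h₁, LinearMap.comp_id]

theorem rTensor {f : V →ₗ[k] W} (hf : TwistHom σ τ f) :
    TwistHom (twistTensor σ υ) (twistTensor τ υ) (LinearMap.rTensor Z f) := by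
  refine TensorProduct.ext' fun x t => ?_
  induction t with
  | zero => simp
  | add a b ha hb => simp only [TensorProduct.tmul_add, map_add, ha, hb]
  | tmul v z =>
    have h := LinearMap.congr_fun hf (x ⊗ₜ v)
    simp only [LinearMap.comp_apply, LinearMap.lTensor_tmul] at h
    simp only [twistTensor, LinearMap.comp_apply, LinearMap.lTensor_tmul, LinearMap.rTensor_tmul,
      LinearEquiv.coe_coe, TensorProduct.assoc_symm_tmul, h]
    generalize σ (x ⊗ₜ v) = t
    induction t with
    | zero => simp
    | add a b ha hb => simp only [TensorProduct.add_tmul, map_add, ha, hb]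
    | tmul v' x' =>
      simp only [LinearMap.rTensor_tmul, LinearMap.lTensor_tmul, TensorProduct.assoc_tmul]
      generalize υ (x' ⊗ₜ z) = t
      induction t with
      | zero => simp
      | add a b ha hb => simp only [TensorProduct.tmul_add, map_add, ha, hb]
      | tmul z' x'' => simp

theorem lTensor {f : V →ₗ[k] W} (hf : TwistHom σ τ f) :
    TwistHom (twistTensor υ σ) (twistTensor υ τ) (LinearMap.lTensor Z f) := by
  refine TensorProduct.ext' fun x t => ?_
  induction t with
  | zero => simp
  | add a b ha hb => simp only [TensorProduct.tmul_add, map_add, ha, hb]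
  | tmul z v =>
    simp only [twistTensor, LinearMap.comp_apply, LinearMap.lTensor_tmul, LinearMap.rTensor_tmul,
      LinearEquiv.coe_coe, TensorProduct.assoc_symm_tmul]
    generalize υ (x ⊗ₜ z) = t
    induction t with
    | zero => simp
    | add a b ha hb => simp only [TensorProduct.add_tmul, map_add, ha, hb]
    | tmul z' x' =>
      have h := LinearMap.congr_fun hf (x' ⊗ₜ v)
      simp only [LinearMap.comp_apply, LinearMap.lTensor_tmul] at h
      simp only [LinearMap.lTensor_tmul, TensorProduct.assoc_tmul, h]
      generalize σ (x' ⊗ₜ v) = t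
      induction t with
      | zero => simp
      | add a b ha hb => simp only [TensorProduct.tmul_add, map_add, ha, hb]
      | tmul v' x'' => simp

theorem map {f : V →ₗ[k] W} {g : U →ₗ[k] Z} (hf : TwistHom σ τ f) (hg : TwistHom ω υ g) :
    TwistHom (twistTensor σ ω) (twistTensor τ υ) (TensorProduct.map f g) := by
  rw [← LinearMap.lTensor_comp_rTensor]
  exact hg.lTensor.comp hf.rTensor

theorem assoc (σ : X ⊗[k] V →ₗ[k] V ⊗[k] X) (τ : X ⊗[k] W →ₗ[k] W ⊗[k] X)
    (υ : X ⊗[k] Z →ₗ[k] Z ⊗[k] X) :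
    TwistHom (twistTensor (twistTensor σ τ) υ) (twistTensor σ (twistTensor τ υ))
      (TensorProduct.assoc k V W Z).toLinearMap := by
  unfold TwistHom
  ext x v w z
  simp only [twistTensor, TensorProduct.AlgebraTensorModule.curry_apply,
    TensorProduct.curry_apply, LinearMap.coe_restrictScalars, LinearMap.comp_apply,
    LinearMap.lTensor_tmul, LinearMap.rTensor_tmul, LinearEquiv.coe_coe,
    TensorProduct.assoc_tmul, TensorProduct.assoc_symm_tmul]
  generalize σ (x ⊗ₜ v) = t
  induction t with
  | zero => simp
  | add a b ha hb => simp only [TensorProduct.add_tmul, map_add, ha, hb]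
  | tmul v' x' =>
    simp only [LinearMap.lTensor_tmul, LinearMap.rTensor_tmul, TensorProduct.assoc_tmul,
      TensorProduct.assoc_symm_tmul, LinearMap.comp_apply, LinearEquiv.coe_coe]
    generalize τ (x' ⊗ₜ w) = t
    induction t with
    | zero => simp
    | add a b ha hb =>
      simp only [TensorProduct.add_tmul, TensorProduct.tmul_add, map_add, ha, hb]
    | tmul w' x'' =>
      simp only [LinearMap.lTensor_tmul, TensorProduct.assoc_tmul,
        TensorProduct.assoc_symm_tmul]
      generalize υ (x'' ⊗ₜ z) = t
      induction t with
      | zero => simp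
      | add a b ha hb => simp only [TensorProduct.tmul_add, map_add, ha, hb]
      | tmul z' x₃ => simp

theorem tensorTwist {σ' : Y ⊗[k] V →ₗ[k] V ⊗[k] Y} {τ' : Y ⊗[k] W →ₗ[k] W ⊗[k] Y}
    {f : V →ₗ[k] W} (hf : TwistHom σ τ f) (hf' : TwistHom σ' τ' f) :
    TwistHom (tensorTwist σ σ') (tensorTwist τ τ') f := by
  unfold TwistHom
  ext x y v
  have h := LinearMap.congr_fun hf' (y ⊗ₜ v)
  simp only [LinearMap.comp_apply, LinearMap.lTensor_tmul] at h
  simp only [_root_.tensorTwist, TensorProduct.AlgebraTensorModule.curry_apply,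
    TensorProduct.curry_apply, LinearMap.coe_restrictScalars, LinearMap.comp_apply,
    LinearMap.lTensor_tmul, LinearEquiv.coe_coe, TensorProduct.assoc_tmul, h]
  generalize σ' (y ⊗ₜ v) = t
  induction t with
  | zero => simp
  | add a b ha hb => simp only [TensorProduct.tmul_add, map_add, ha, hb]
  | tmul v' y' =>
    have h := LinearMap.congr_fun hf (x ⊗ₜ v')
    simp only [LinearMap.comp_apply, LinearMap.lTensor_tmul] at h
    simp only [LinearMap.rTensor_tmul, TensorProduct.assoc_symm_tmul, h]
    generalize σ (x ⊗ₜ v') = t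
    induction t with
    | zero => simp
    | add a b ha hb => simp only [TensorProduct.add_tmul, map_add, ha, hb]
    | tmul v'' x' => simp

end TwistHom

theorem tensorTwist_twistTensor (σ : X ⊗[k] V →ₗ[k] V ⊗[k] X) (τ : X ⊗[k] W →ₗ[k] W ⊗[k] X)
    (σ' : Y ⊗[k] V →ₗ[k] V ⊗[k] Y) (τ' : Y ⊗[k] W →ₗ[k] W ⊗[k] Y) :
    tensorTwist (twistTensor σ τ) (twistTensor σ' τ')
      = twistTensor (tensorTwist σ σ') (tensorTwist τ τ') := by
  ext x y v w
  simp only [twistTensor, tensorTwist, TensorProduct.AlgebraTensorModule.curry_apply,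
    TensorProduct.curry_apply, LinearMap.coe_restrictScalars, LinearMap.comp_apply,
    LinearMap.lTensor_tmul, LinearMap.rTensor_tmul, LinearEquiv.coe_coe,
    TensorProduct.assoc_tmul, TensorProduct.assoc_symm_tmul]
  generalize σ' (y ⊗ₜ v) = t
  induction t with
  | zero => simp
  | add a b ha hb =>
    simp only [TensorProduct.add_tmul, TensorProduct.tmul_add, map_add, ha, hb]
  | tmul v' y' =>
    simp only [LinearMap.lTensor_tmul, LinearMap.rTensor_tmul, TensorProduct.assoc_tmul,
      TensorProduct.assoc_symm_tmul]
    have key : ∀ (p : V ⊗[k] X) (q : W ⊗[k] Y),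
        (TensorProduct.assoc k (V ⊗[k] W) X Y)
          ((LinearMap.rTensor Y ((TensorProduct.assoc k V W X).symm.toLinearMap
            ∘ₗ LinearMap.lTensor V τ ∘ₗ (TensorProduct.assoc k V X W).toLinearMap))
            ((TensorProduct.assoc k (V ⊗[k] X) W Y).symm (p ⊗ₜ q)))
        = (TensorProduct.assoc k V W (X ⊗[k] Y)).symm
          ((LinearMap.lTensor V ((TensorProduct.assoc k W X Y).toLinearMap
            ∘ₗ LinearMap.rTensor Y τ ∘ₗ (TensorProduct.assoc k X W Y).symm.toLinearMap))
            ((TensorProduct.assoc k V X (W ⊗[k] Y)) (p ⊗ₜ q))) := by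
      intro p q
      induction q with
      | zero => simp
      | add a b ha hb => simp only [TensorProduct.tmul_add, map_add, ha, hb]
      | tmul w' y'' =>
        induction p with
        | zero => simp
        | add a b ha hb => simp only [TensorProduct.add_tmul, map_add, ha, hb]
        | tmul v'' x' =>
          simp only [LinearMap.lTensor_tmul, LinearMap.rTensor_tmul, TensorProduct.assoc_tmul,
            TensorProduct.assoc_symm_tmul, LinearMap.comp_apply, LinearEquiv.coe_coe]
          generalize τ (x' ⊗ₜ w') = t
          induction t with
          | zero => simp
          | add a b ha hb =>
            simp only [TensorProduct.add_tmul, TensorProduct.tmul_add, map_add, ha, hb]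
          | tmul w'' x'' => simp
    have key' := key (σ (x ⊗ₜ v')) (τ' (y' ⊗ₜ w))
    trans
    · trans
      swap
      · exact key'
      generalize τ' (y' ⊗ₜ w) = t
      induction t with
      | zero => simp
      | add a b ha hb =>
        simp only [TensorProduct.tmul_add, map_add, ha, hb]
      | tmul w' y'' => simp
    · generalize σ (x ⊗ₜ v') = t
      induction t with
      | zero => simp
      | add a b ha hb =>
        simp only [TensorProduct.add_tmul, map_add, ha, hb]
      | tmul v'' x' => simp

end TwistStructure

section Powers

variable {k : Type u} [Field k] {X V : Type u} [AddCommGroup X] [Module k X]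
  [AddCommGroup V] [Module k V]

theorem twistHom_snoc (t : X ⊗[k] V ≃ₗ[k] V ⊗[k] X) (l : ℕ) :
    TwistHom (twistTensor (twE1 t l).toLinearMap t.toLinearMap) (twE1 t (l + 1)).toLinearMap
      (snoc k l).toLinearMap := by
  refine TensorProduct.ext' fun x z => ?_
  simp [twE1, twistTensor, LinearMap.rTensor, LinearMap.lTensor,
    TensorProduct.congr]

theorem twE1_succ_eq_twistTensor (t : X ⊗[k] V ≃ₗ[k] V ⊗[k] X) (l : ℕ) :
    (twE1 t (l + 1)).toLinearMap = twistTensor t.toLinearMap (twE1 t l).toLinearMap := by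
  have eq_of {l : ℕ} {τ : X ⊗[k] ↥(pw k V (l + 1)) →ₗ[k] ↥(pw k V (l + 1)) ⊗[k] X}
      (h : TwistHom (twistTensor (twE1 t l).toLinearMap t.toLinearMap) τ
        (snoc k l).toLinearMap) : (twE1 t (l + 1)).toLinearMap = τ := by
    have := (twistHom_snoc t l).trans (Eq.symm h)
    exact (LinearMap.cancel_right
      (LinearMap.lTensor_surjective X (snoc k l).surjective)).mp this
  induction l with
  | zero => exact eq_of (TwistHom.id (σ := twistTensor t.toLinearMap t.toLinearMap))
  | succ l ih =>
    refine eq_of ?_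
    have h := (twistHom_snoc t l).lTensor (υ := t.toLinearMap)
    have h' := h.comp (TwistHom.assoc t.toLinearMap (twE1 t l).toLinearMap t.toLinearMap)
    rw [ih] at h' ⊢
    exact h'

theorem twEFull_succ_eq_tensorTwist (t : X ⊗[k] V ≃ₗ[k] V ⊗[k] X) (j l : ℕ) :
    (twEFull t (j + 1) l).toLinearMap
      = tensorTwist (twE1 t l).toLinearMap (twEFull t j l).toLinearMap := rfl

end Powers

section Compatibility

variable {k : Type u} [Field k] {H A : Type u} [AddCommGroup H] [Module k H]
  [AddCommGroup A] [Module k A] {c : H ⊗[k] H ≃ₗ[k] H ⊗[k] H} {s : H ⊗[k] A ≃ₗ[k] A ⊗[k] H}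
  {Δ : H →ₗ[k] H ⊗[k] H} {ρ : H ⊗[k] A →ₗ[k] A}

theorem TwistHom.twE1 (hs : TwistHom (twistTensor c.toLinearMap s.toLinearMap)
    (twistTensor s.toLinearMap c.toLinearMap) s.toLinearMap) (l : ℕ) :
    TwistHom (twistTensor c.toLinearMap (twE1 s l).toLinearMap)
      (twistTensor (twE1 s l).toLinearMap c.toLinearMap) (twE1 s l).toLinearMap := by
  induction l with
  | zero => exact hs
  | succ l ih =>
    have hsn := twistHom_snoc s l
    exact hsn.rTensor.comp <| (TwistHom.assoc _ _ _).symm.comp <| hs.lTensor.comp <|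
      (TwistHom.assoc _ _ _).comp <| ih.rTensor.comp <| (TwistHom.assoc _ _ _).symm.comp
        hsn.symm.lTensor

theorem TwistHom.rhoPow (hs : TwistHom (twistTensor c.toLinearMap s.toLinearMap)
      (twistTensor s.toLinearMap c.toLinearMap) s.toLinearMap)
    (hΔ : TwistHom c.toLinearMap (twistTensor c.toLinearMap c.toLinearMap) Δ)
    (hρ : TwistHom (twistTensor c.toLinearMap s.toLinearMap) s.toLinearMap ρ) (l : ℕ) :
    TwistHom (twistTensor c.toLinearMap (_root_.twE1 s l).toLinearMap)
      (_root_.twE1 s l).toLinearMap (rhoPow Δ s ρ l) := by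
  induction l with
  | zero => exact hρ
  | succ l ih =>
    have hsn := twistHom_snoc s l
    exact hsn.comp <| (ih.map hρ).comp <| (TwistHom.assoc _ _ _).symm.comp <|
      (TwistHom.assoc _ _ _).lTensor.comp <| (TwistHom.twE1 hs l).rTensor.lTensor.comp <|
      (TwistHom.assoc _ _ _).symm.lTensor.comp <| (TwistHom.assoc _ _ _).comp <|
      hΔ.rTensor.comp hsn.symm.lTensor

theorem TwistHom.rhoFull (hs : TwistHom (twistTensor c.toLinearMap s.toLinearMap)
      (twistTensor s.toLinearMap c.toLinearMap) s.toLinearMap)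
    (hΔ : TwistHom c.toLinearMap (twistTensor c.toLinearMap c.toLinearMap) Δ)
    (hρ : TwistHom (twistTensor c.toLinearMap s.toLinearMap) s.toLinearMap ρ) (m r : ℕ) :
    TwistHom (twistTensor (_root_.twE1 c m).toLinearMap (_root_.twE1 s r).toLinearMap)
      (_root_.twE1 s r).toLinearMap (rhoFull Δ s ρ m r) := by
  induction m with
  | zero => exact TwistHom.rhoPow hs hΔ hρ r
  | succ m ih =>
    rw [twE1_succ_eq_twistTensor]
    exact (TwistHom.rhoPow hs hΔ hρ r).comp <| ih.lTensor.comp (TwistHom.assoc _ _ _)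

theorem TwistHom.twEFull {m r : ℕ} {f : ↥(pw k H m) ⊗[k] ↥(pw k A r) →ₗ[k] ↥(pw k A r)}
    (hf : TwistHom (twistTensor (_root_.twE1 c m).toLinearMap (_root_.twE1 s r).toLinearMap)
      (_root_.twE1 s r).toLinearMap f) (n : ℕ) :
    TwistHom (twistTensor (twEFull c n m).toLinearMap (twEFull s n r).toLinearMap)
      (twEFull s n r).toLinearMap f := by
  induction n with
  | zero => exact hf
  | succ n ih =>
    rw [twEFull_succ_eq_tensorTwist, twEFull_succ_eq_tensorTwist]
    have h := hf.tensorTwist ih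
    rw [tensorTwist_twistTensor] at h
    exact h

end Compatibility

/-- `𝔰_{n,r}∘(id⊗ρ_{m,r}) = (ρ_{m,r}⊗id)∘(id⊗𝔰_{n,r})∘(𝔠_{n,m}⊗id)`. -/
theorem sFull_rhoFull_eq {H A : Type u} [Ring H] [Algebra k H] [Coalgebra k H]
    [Ring A] [Algebra k A]
    (bb : BraidedBialgebra k H) (tr : Transposition k bb.c A)
    (wa : WeakSAction k bb.c tr.s) :
    ∀ n m r : ℕ,
      (twEFull tr.s n r).toLinearMap
          ∘ₗ LinearMap.lTensor ↥(pw k H n)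
              (rhoFull (Coalgebra.comul (R := k) (A := H)) tr.s wa.ρ m r)
        = LinearMap.rTensor ↥(pw k H n)
              (rhoFull (Coalgebra.comul (R := k) (A := H)) tr.s wa.ρ m r)
          ∘ₗ (TensorProduct.assoc k ↥(pw k H m) ↥(pw k A r) ↥(pw k H n)).symm.toLinearMap
          ∘ₗ LinearMap.lTensor ↥(pw k H m) (twEFull tr.s n r).toLinearMap
          ∘ₗ (TensorProduct.assoc k ↥(pw k H m) ↥(pw k H n) ↥(pw k A r)).toLinearMap
          ∘ₗ LinearMap.rTensor ↥(pw k A r) (twEFull bb.c n m).toLinearMap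
          ∘ₗ (TensorProduct.assoc k ↥(pw k H n) ↥(pw k H m) ↥(pw k A r)).symm.toLinearMap := by
  have hs : TwistHom (twistTensor bb.c.toLinearMap tr.s.toLinearMap)
      (twistTensor tr.s.toLinearMap bb.c.toLinearMap) tr.s.toLinearMap := by
    have h := tr.s_braid
    refine LinearMap.ext fun x => ?_
    have hx := LinearMap.congr_fun h ((TensorProduct.assoc k H H A).symm x)
    apply (TensorProduct.assoc k A H H).injective
    simpa [twistTensor] using hx.symm
  have hΔ : TwistHom bb.c.toLinearMap (twistTensor bb.c.toLinearMap bb.c.toLinearMap)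
      (Coalgebra.comul (R := k) (A := H)) := by
    have h := bb.braid_comul_left
    refine LinearMap.ext fun x => ?_
    have hx := LinearMap.congr_fun h x
    apply (TensorProduct.assoc k H H H).injective
    simpa [twistTensor] using hx.symm
  intro n m r
  exact (TwistHom.rhoFull hs hΔ wa.rho_s m r).twEFull n
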